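/- In multiclass classification under the 0-1 loss, proper PAC learnability is not a monotone property of the hypothesis class: there exist a domain X, a label set Y, and hypothesis classes H₀ ⊊ H₁ ⊊ H₂ ⊆ Y^X such that H₀ and H₂ are properly PAC learnable but H₁ is not properly PAC learnable. -/

import Mathlib

noncomputable section
open scoped ENNReal Classical

/-- The true error under 0-1 loss: `L_{D,h*}(f) = P_{x∼D}(f(x) ≠ h*(x))`. -/
def trueError01 {X Y : Type*} (D : PMF X) (hstar f : X → Y) : ℝ :=
  ∑' x, (D x).toReal * (if f x = hstar x then 0 else 1)

/-- The probability weight of an i.i.d. tuple `sx` of `k` draws from `D`. -/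
def sampleProb {X : Type*} (D : PMF X) (k : ℕ) (sx : Fin k → X) : ℝ :=
  ∏ i, (D (sx i)).toReal

/-- `H` is properly PAC learnable (realizable case, 0-1 loss): there is a
(randomized) learner emitting hypotheses in `H` and a sample function `m` such
that for all `ε, δ ∈ (0,1)`, all marginals `D`, all ground truths `h* ∈ H`, and
all sample sizes `k ≥ m ε δ`, with probability at least `1 − δ` over the sample
and the learner's randomness, the output has true error at most `ε`. -/
def ProperlyPACLearnable {X Y : Type*} (H : Set (X → Y)) : Prop :=
  ∃ A : List (X × Y) → PMF H, ∃ m : ℝ → ℝ → ℕ,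
    ∀ ε δ : ℝ, 0 < ε → ε < 1 → 0 < δ → δ < 1 →
      ∀ D : PMF X, ∀ hstar ∈ H, ∀ k, m ε δ ≤ k →
        1 - δ ≤ ∑' sx : Fin k → X, sampleProb D k sx *
          ∑' h : H, ((A (List.ofFn fun i => (sx i, hstar (sx i)))) h).toReal *
            (if trueError01 D hstar (↑h) ≤ ε then 1 else 0)

/-- The hypothesis attached to a Boolean sequence `g`: it is `none` on the graph of `g` and
reveals `g` off the graph. -/
def hyp (g : ℕ → Bool) : ℕ × Bool → Option (ℕ → Bool) :=
  fun x => if x.2 = g x.1 then none else some g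

/-- The constant hypothesis `none`. -/
def hypNone : ℕ × Bool → Option (ℕ → Bool) := fun _ => none

lemma hasSum_pi_pow {X : Type*} {w : X → ℝ} (hw : ∀ x, 0 ≤ w x) {a : ℝ} (h : HasSum w a) :
    ∀ k : ℕ, HasSum (fun sx : Fin k → X => ∏ i, w (sx i)) (a ^ k) := by
  intro k
  induction k with
  | zero =>
    simp
  | succ k ih =>
    have hs : Summable (fun p : X × (Fin k → X) => w p.1 * ∏ i, w (p.2 i)) :=
      Summable.mul_of_nonneg (g := fun sx : Fin k → X => ∏ i, w (sx i)) h.summable ih.summable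
        hw (fun _ => Finset.prod_nonneg fun _ _ => hw _)
    have h2 := HasSum.mul h ih hs
    rw [← pow_succ'] at h2
    rw [← (Fin.consEquiv (fun _ : Fin (k + 1) => X)).hasSum_iff]
    refine Eq.mpr (congrArg (fun f => HasSum f (a ^ (k + 1))) (funext fun p => ?_)) h2
    rw [Function.comp_apply, Fin.prod_univ_succ]
    rfl

lemma pmf_hasSum {X : Type*} (D : PMF X) : HasSum (fun x => (D x).toReal) 1 := by
  have h : Summable (fun x => (D x).toReal) := ENNReal.summable_toReal D.tsum_coe_ne_top
  have h2 : ∑' x, (D x).toReal = 1 := by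
    rw [← ENNReal.tsum_toReal_eq (fun x => D.apply_ne_top x), D.tsum_coe]; rfl
  exact h2 ▸ h.hasSum

lemma pure_sum {H : Type*} (h0 : H) (c : H → ℝ) :
    ∑' h : H, ((PMF.pure h0) h).toReal * c h = c h0 := by
  rw [tsum_eq_single h0]
  · simp
  · intro b hb
    simp [PMF.pure_apply, hb]

lemma trueError01_self {X Y : Type*} (D : PMF X) (h : X → Y) : trueError01 D h h = 0 := by
  simp [trueError01]

lemma sampleProb_hasSum {X : Type*} (D : PMF X) (k : ℕ) : HasSum (sampleProb D k) 1 := by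
  have := hasSum_pi_pow (fun x => ENNReal.toReal_nonneg) (pmf_hasSum D) k
  rw [one_pow] at this
  exact this

lemma learn_singleton {X Y : Type*} (h0 : X → Y) :
    ProperlyPACLearnable ({h0} : Set (X → Y)) := by
  refine ⟨fun _ => PMF.pure ⟨h0, rfl⟩, fun _ _ => 0, ?_⟩
  intro ε δ hε _ hδ _ D hstar hh k _
  rw [Set.mem_singleton_iff] at hh
  subst hh
  simp only [pure_sum (c := fun h : ({hstar} : Set (X → Y)) =>
    if trueError01 D hstar (↑h) ≤ ε then (1 : ℝ) else 0), trueError01_self, hε.le, if_true, mul_one]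
  rw [(sampleProb_hasSum D k).tsum_eq]
  linarith

/-- The learner for the large class. -/
def learner (L : List ((ℕ × Bool) × Option (ℕ → Bool))) :
    (insert hypNone (Set.range hyp) : Set (ℕ × Bool → Option (ℕ → Bool))) :=
  if h : ∃ g x, (x, some g) ∈ L then ⟨hyp h.choose, Or.inr ⟨_, rfl⟩⟩ else ⟨hypNone, Or.inl rfl⟩

lemma learner_of_mem (g : ℕ → Bool) (k : ℕ) (sx : Fin k → ℕ × Bool) (i : Fin k)
    (hi : hyp g (sx i) ≠ none) :
    (learner (List.ofFn fun i => (sx i, hyp g (sx i)))).1 = hyp g := by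
  have key : ∀ g' x, (x, some g') ∈ List.ofFn (fun i => (sx i, hyp g (sx i))) → g' = g := by
    intro g' x hx
    rw [List.mem_ofFn] at hx
    obtain ⟨j, hj⟩ := hx
    have := (Prod.ext_iff.1 hj).2
    simp only [hyp] at this
    split_ifs at this
    simpa using this.symm
  have hex : ∃ g' x, (x, some g') ∈ List.ofFn (fun i => (sx i, hyp g (sx i))) := by
    refine ⟨g, sx i, ?_⟩
    rw [List.mem_ofFn]
    refine ⟨i, ?_⟩
    simp only [hyp] at hi ⊢
    split_ifs with h
    · simp [h] at hi
    · rfl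
  unfold learner
  rw [dif_pos hex]
  obtain ⟨x, hx⟩ := hex.choose_spec
  exact congrArg hyp (key _ x hx)

lemma learner_of_not (h : ℕ × Bool → Option (ℕ → Bool)) (k : ℕ) (sx : Fin k → ℕ × Bool)
    (hi : ∀ i, h (sx i) = none) :
    (learner (List.ofFn fun i => (sx i, h (sx i)))).1 = hypNone := by
  unfold learner
  rw [dif_neg]
  rintro ⟨g, x, hx⟩
  rw [List.mem_ofFn] at hx
  obtain ⟨j, hj⟩ := hx
  have := (Prod.ext_iff.1 hj).2
  simp [hi] at this

lemma learn_large : ProperlyPACLearnable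
    (insert hypNone (Set.range hyp) : Set (ℕ × Bool → Option (ℕ → Bool))) := by
  have hm : ∀ ε δ : ℝ, ∃ m : ℕ, 0 < ε → ε < 1 → 0 < δ → (1 - ε) ^ m < δ := by
    intro ε δ
    by_cases h : 0 < ε ∧ 0 < δ
    · obtain ⟨m, hm⟩ := exists_pow_lt_of_lt_one h.2 (show 1 - ε < 1 by linarith [h.1])
      exact ⟨m, fun _ _ _ => hm⟩
    · exact ⟨0, fun h1 _ h2 => absurd ⟨h1, h2⟩ h⟩
  choose m hm using hm
  refine ⟨fun L => PMF.pure (learner L), m, ?_⟩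
  intro ε δ hε hε1 hδ _ D hstar hh k hk
  have hmk := hm ε δ hε hε1 hδ
  simp only [pure_sum (c := fun h : (insert hypNone (Set.range hyp) :
    Set (ℕ × Bool → Option (ℕ → Bool))) =>
    if trueError01 D hstar (↑h) ≤ ε then (1 : ℝ) else 0)]
  have hnn : ∀ sx, 0 ≤ sampleProb D k sx :=
    fun sx => Finset.prod_nonneg fun _ _ => ENNReal.toReal_nonneg
  have hP := sampleProb_hasSum D k
  by_cases hp : trueError01 D hstar hypNone ≤ ε
  · have : ∀ sx : Fin k → ℕ × Bool,
        trueError01 D hstar (learner (List.ofFn fun i => (sx i, hstar (sx i)))).1 ≤ ε := by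
      intro sx
      by_cases hi : ∀ i, hstar (sx i) = none
      · rw [learner_of_not _ _ _ hi]; exact hp
      · push Not at hi
        obtain ⟨i, hi⟩ := hi
        rcases hh with rfl | ⟨g, rfl⟩
        · exact absurd rfl hi
        · rw [learner_of_mem g k sx i hi, trueError01_self]; exact hε.le
    simp only [this, if_true, mul_one]
    rw [hP.tsum_eq]; linarith
  · rcases hh with rfl | ⟨g, rfl⟩
    · rw [trueError01_self] at hp; exact absurd hε.le hp
    have hD := pmf_hasSum D
    have hsE : Summable (fun x => (D x).toReal * (if hypNone x = hyp g x then (0:ℝ) else 1)) := by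
      refine Summable.of_nonneg_of_le (fun x => ?_) (fun x => ?_) hD.summable
      · split_ifs <;> simp
      · split_ifs <;> simp
    have hE : HasSum (fun x => (D x).toReal * (if hypNone x = hyp g x then (0:ℝ) else 1))
        (trueError01 D (hyp g) hypNone) := by
      unfold trueError01
      convert hsE.hasSum
    have hw := hD.sub hE
    set p := trueError01 D (hyp g) hypNone with hpdef
    have hwnn : ∀ x, 0 ≤ (D x).toReal - (D x).toReal *
        (if hypNone x = hyp g x then (0:ℝ) else 1) := by
      intro x; split_ifs <;> simp
    have hQ := hasSum_pi_pow hwnn hw k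
    have hp1 : 0 ≤ 1 - p := hw.nonneg hwnn
    push Not at hp
    have hle : (1 - p) ^ k ≤ δ := by
      calc (1 - p) ^ k ≤ (1 - ε) ^ k := by gcongr
        _ ≤ (1 - ε) ^ (m ε δ) := pow_le_pow_of_le_one (by linarith) (by linarith) hk
        _ ≤ δ := hmk.le
    have hdiff := hP.sub hQ
    have hsF : Summable (fun sx : Fin k → ℕ × Bool => sampleProb D k sx *
        (if trueError01 D (hyp g) (learner (List.ofFn fun i => (sx i, hyp g (sx i)))).1 ≤ ε
          then (1 : ℝ) else 0)) := by
      refine Summable.of_nonneg_of_le (fun sx => ?_) (fun sx => ?_) hP.summable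
      · split_ifs <;> simp [hnn]
      · split_ifs <;> simp [hnn]
    have := hasSum_le (fun sx => ?_) hdiff hsF.hasSum
    · linarith
    · by_cases hi : ∀ i, hyp g (sx i) = none
      · have e : sampleProb D k sx = ∏ i, ((D (sx i)).toReal - (D (sx i)).toReal *
            (if hypNone (sx i) = hyp g (sx i) then (0:ℝ) else 1)) := by
          unfold sampleProb
          refine Finset.prod_congr rfl fun i _ => ?_
          rw [hi i]; simp [hypNone]
        rw [← e, sub_self]
        split_ifs <;> simp [hnn]
      · push Not at hi
        obtain ⟨i, hi⟩ := hi
        rw [learner_of_mem g k sx i hi, trueError01_self, if_pos hε.le, mul_one]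
        have := Finset.prod_nonneg (s := Finset.univ) fun i (_ : i ∈ Finset.univ) => hwnn (sx i)
        linarith

/-- Extension of a finite Boolean sequence. -/
def extSeq {n : ℕ} (g : Fin n → Bool) : ℕ → Bool := fun i => if h : i < n then g ⟨i, h⟩ else false

/-- Point of the graph. -/
def pt {n : ℕ} (g : Fin n → Bool) (i : Fin n) : ℕ × Bool := (i, g i)

lemma pt_inj {n : ℕ} (g : Fin n → Bool) : Function.Injective (pt g) := by
  intro i j h
  exact Fin.ext (Prod.ext_iff.1 h).1

lemma hyp_pt {n : ℕ} (g : Fin n → Bool) (i : Fin n) : hyp (extSeq g) (pt g i) = none := by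
  simp [hyp, extSeq, pt]

/-- Uniform distribution on the graph. -/
def unif {n : ℕ} [NeZero n] (g : Fin n → Bool) : PMF (ℕ × Bool) :=
  (PMF.uniformOfFintype (Fin n)).map (pt g)

lemma unif_pt {n : ℕ} [NeZero n] (g : Fin n → Bool) (i : Fin n) :
    (unif g (pt g i)).toReal = (n : ℝ)⁻¹ := by
  unfold unif
  rw [PMF.map_apply, tsum_eq_single i]
  · simp
  · intro j hj
    rw [if_neg]
    exact fun h => hj (pt_inj g h).symm

lemma unif_not {n : ℕ} [NeZero n] (g : Fin n → Bool) (x : ℕ × Bool) (hx : x ∉ Set.range (pt g)) :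
    (unif g x).toReal = 0 := by
  unfold unif
  rw [PMF.map_apply]
  have : ∀ a, ¬ (x = pt g a) := fun a h => hx ⟨a, h.symm⟩
  simp [this]

lemma sum_samples {n : ℕ} [NeZero n] (g : Fin n → Bool) (k : ℕ)
    (φ : (Fin k → ℕ × Bool) → ℝ) :
    ∑' sx, sampleProb (unif g) k sx * φ sx =
      ∑ t : Fin k → Fin n, ((n : ℝ)⁻¹) ^ k * φ (fun j => pt g (t j)) := by
  have hinj : Function.Injective (fun (t : Fin k → Fin n) (j : Fin k) => pt g (t j)) := by
    intro t t' h
    funext j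
    exact pt_inj g (congrFun h j)
  rw [← hinj.tsum_eq, tsum_fintype]
  · refine Finset.sum_congr rfl fun t _ => ?_
    simp [sampleProb, unif_pt]
  · intro sx hsx
    by_contra hcon
    apply hsx
    have : ∃ j, sx j ∉ Set.range (pt g) := by
      by_contra hall
      push Not at hall
      choose t ht using hall
      exact hcon ⟨t, funext ht⟩
    obtain ⟨j, hj⟩ := this
    have : sampleProb (unif g) k sx = 0 :=
      Finset.prod_eq_zero (Finset.mem_univ j) (unif_not g _ hj)
    simp [this]

lemma err_eq {n : ℕ} [NeZero n] (g : Fin n → Bool) (g' : ℕ → Bool) :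
    trueError01 (unif g) (hyp (extSeq g)) (hyp g') =
      ∑ i : Fin n, (n : ℝ)⁻¹ * (if g i = g' i then 0 else 1) := by
  unfold trueError01
  rw [← (pt_inj g).tsum_eq, tsum_fintype]
  · refine Finset.sum_congr rfl fun i _ => ?_
    rw [unif_pt, hyp_pt]
    by_cases h : g i = g' i <;> simp [hyp, pt, h]
  · intro x hx
    by_contra hcon
    apply hx
    simp [unif_not g x hcon]

/-- Flip `g` outside the range of `t`. -/
def flipOff {n k : ℕ} (t : Fin k → Fin n) (g : Fin n → Bool) : Fin n → Bool :=
  fun i => if i ∈ Set.range t then g i else !(g i)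

lemma flipOff_flipOff {n k : ℕ} (t : Fin k → Fin n) (g : Fin n → Bool) : flipOff t (flipOff t g) = g := by
  funext i
  unfold flipOff
  split_ifs <;> simp

lemma err_pair {n k : ℕ} [NeZero n] (hn : n = 2 * k + 1) (t : Fin k → Fin n) (g : Fin n → Bool)
    (g' : ℕ → Bool) :
    1 / 2 ≤ trueError01 (unif g) (hyp (extSeq g)) (hyp g') +
      trueError01 (unif (flipOff t g)) (hyp (extSeq (flipOff t g))) (hyp g') := by
  rw [err_eq, err_eq, ← Finset.sum_add_distrib]
  have hpos : (0 : ℝ) < n := by rw [hn]; positivity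
  have h1 : ∀ i : Fin n, (n : ℝ)⁻¹ * (if i ∈ Finset.univ.image t then 0 else 1) ≤
      (n : ℝ)⁻¹ * (if g i = g' i then 0 else 1) +
      (n : ℝ)⁻¹ * (if flipOff t g i = g' i then 0 else 1) := by
    intro i
    rw [← mul_add]
    refine mul_le_mul_of_nonneg_left ?_ (by positivity)
    have e : (i ∈ Finset.univ.image t) ↔ i ∈ Set.range t := by simp
    by_cases h : i ∈ Set.range t
    · rw [if_pos (e.2 h)]; split_ifs <;> norm_num
    · rw [if_neg (fun h' => h (e.1 h'))]
      simp only [flipOff, h, if_false]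
      cases g i <;> cases g' i <;> simp
  refine le_trans ?_ (Finset.sum_le_sum fun i _ => h1 i)
  rw [← Finset.mul_sum]
  have h2 : ∑ i : Fin n, (if i ∈ Finset.univ.image t then (0:ℝ) else 1) =
      n - (Finset.univ.image t).card := by
    have : ∀ i : Fin n, (if i ∈ Finset.univ.image t then (0:ℝ) else 1) =
      1 - (if i ∈ Finset.univ.image t then (1:ℝ) else 0) := by
      intro i; split_ifs <;> norm_num
    simp only [this, Finset.sum_sub_distrib]
    rw [Finset.sum_ite_mem]
    simp
  rw [h2]
  have h3 : ((Finset.univ.image t).card : ℝ) ≤ k := by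
    have := Finset.card_image_le (s := Finset.univ) (f := t)
    simp only [Finset.card_univ, Fintype.card_fin] at this
    exact_mod_cast this
  rw [inv_mul_eq_div, le_div_iff₀ hpos]
  have : (n : ℝ) = 2 * k + 1 := by rw [hn]; push_cast; ring
  linarith

lemma pmf_pair {α : Type*} (q : PMF α) (a b : α → ℝ) (hab : ∀ x, 1 / 2 ≤ a x + b x) :
    ∑' x, (q x).toReal * (if a x ≤ 1/10 then 1 else 0) +
      ∑' x, (q x).toReal * (if b x ≤ 1/10 then 1 else 0) ≤ 1 := by
  have hq := pmf_hasSum q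
  have hs : ∀ a : α → ℝ,
      Summable (fun h => (q h).toReal * (if a h ≤ 1/10 then (1:ℝ) else 0)) := by
    intro a
    refine Summable.of_nonneg_of_le (fun x => ?_) (fun x => ?_) hq.summable
    · split_ifs <;> simp
    · split_ifs <;> simp
  rw [← (hs a).tsum_add (hs b)]
  refine hasSum_le (fun h => ?_) ((hs a).add (hs b)).hasSum hq
  have := hab h
  have hc : 0 ≤ (q h).toReal := ENNReal.toReal_nonneg
  by_cases ha : a h ≤ 1/10
  · have hb : ¬ b h ≤ 1/10 := fun hb => by linarith
    rw [if_pos ha, if_neg hb]; linarith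
  · rw [if_neg ha]
    by_cases hb : b h ≤ 1/10
    · rw [if_pos hb]; linarith
    · rw [if_neg hb]; linarith

lemma not_learn : ¬ ProperlyPACLearnable (Set.range hyp) := by
  rintro ⟨A, m, hA⟩
  have h0 := hA (1/10) (1/10) (by norm_num) (by norm_num) (by norm_num) (by norm_num)
  set k := m (1/10) (1/10) with hk
  clear_value k
  obtain ⟨n, hn⟩ : ∃ n, n = 2 * k + 1 := ⟨_, rfl⟩
  have : NeZero n := ⟨by omega⟩
  let W : (Fin k → Fin n) → (Fin n → Bool) → ℝ := fun t g =>
    ∑' h : Set.range hyp, ((A (List.ofFn fun j => (pt g (t j), hyp (extSeq g) (pt g (t j))))) h).toReal *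
            (if trueError01 (unif g) (hyp (extSeq g)) (↑h) ≤ 1/10 then 1 else 0)
  have h1 : ∀ g : Fin n → Bool, 1 - 1/10 ≤ ∑ t : Fin k → Fin n, ((n : ℝ)⁻¹) ^ k * W t g := by
    intro g
    have := h0 (unif g) (hyp (extSeq g)) ⟨_, rfl⟩ k le_rfl
    rwa [sum_samples g k (fun sx => ∑' h : Set.range hyp,
      ((A (List.ofFn fun j => (sx j, hyp (extSeq g) (sx j)))) h).toReal *
            (if trueError01 (unif g) (hyp (extSeq g)) (↑h) ≤ 1/10 then 1 else 0))] at this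
  have hpair : ∀ t g, W t g + W t (flipOff t g) ≤ 1 := by
    intro t g
    have eL : (List.ofFn fun j => (pt (flipOff t g) (t j), hyp (extSeq (flipOff t g)) (pt (flipOff t g) (t j))))
        = (List.ofFn fun j => (pt g (t j), hyp (extSeq g) (pt g (t j)))) := by
      congr 1
      funext j
      rw [hyp_pt, hyp_pt]
      simp [pt, flipOff]
    simp only [W]
    rw [eL]
    generalize A (List.ofFn fun j => (pt g (t j), hyp (extSeq g) (pt g (t j)))) = q
    refine pmf_pair q (fun h => trueError01 (unif g) (hyp (extSeq g)) h.1)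
      (fun h => trueError01 (unif (flipOff t g)) (hyp (extSeq (flipOff t g))) h.1) ?_
    rintro ⟨_, g', rfl⟩
    exact err_pair hn t g g'
  have hsum : ∀ t, ∑ g, W t g ≤ (2:ℝ) ^ n / 2 := by
    intro t
    have e : ∑ g, W t (flipOff t g) = ∑ g, W t g :=
      Equiv.sum_comp (Function.Involutive.toPerm (flipOff t) (flipOff_flipOff t)) (W t)
    have := Finset.sum_le_sum fun g (_ : g ∈ Finset.univ) => hpair t g
    rw [Finset.sum_add_distrib, e] at this
    simp at this
    linarith
  have h2 := Finset.sum_le_sum fun g (_ : g ∈ Finset.univ) => h1 g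
  rw [Finset.sum_comm] at h2
  have h3 : ∑ t : Fin k → Fin n, ∑ g, ((n : ℝ)⁻¹) ^ k * W t g ≤
      ∑ t : Fin k → Fin n, ((n : ℝ)⁻¹) ^ k * ((2:ℝ) ^ n / 2) := by
    refine Finset.sum_le_sum fun t _ => ?_
    rw [← Finset.mul_sum]
    exact mul_le_mul_of_nonneg_left (hsum t) (by positivity)
  have hn0 : (n : ℝ) ≠ 0 := by exact_mod_cast NeZero.ne n
  have h4 : ∑ t : Fin k → Fin n, ((n : ℝ)⁻¹) ^ k * ((2:ℝ) ^ n / 2) = (2:ℝ) ^ n / 2 := by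
    simp only [Finset.sum_const, Finset.card_univ, Fintype.card_fun, Fintype.card_fin, nsmul_eq_mul]
    push_cast
    rw [← mul_assoc, ← mul_pow, mul_inv_cancel₀ hn0, one_pow, one_mul]
  rw [h4] at h3
  have h5 := h2.trans h3
  simp only [Finset.sum_const, Finset.card_univ, Fintype.card_fun, Fintype.card_fin,
    Fintype.card_bool, nsmul_eq_mul] at h5
  push_cast at h5
  have : (0:ℝ) < 2 ^ n := by positivity
  linarith

/-- **Proper PAC learnability is not monotone.** There exist a domain `X`, a label
set `Y`, and hypothesis classes `H₀ ⊊ H₁ ⊊ H₂ ⊆ Y^X` such that `H₀` and `H₂` are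
properly PAC learnable but `H₁` is not. -/
theorem proper_learnability_not_monotone :
    ∃ (X Y : Type) (H₀ H₁ H₂ : Set (X → Y)),
      H₀ ⊂ H₁ ∧ H₁ ⊂ H₂ ∧
      ProperlyPACLearnable H₀ ∧ ProperlyPACLearnable H₂ ∧
      ¬ ProperlyPACLearnable H₁ := by
  refine ⟨ℕ × Bool, Option (ℕ → Bool), {hyp fun _ => false}, Set.range hyp,
    insert hypNone (Set.range hyp), ?_, ?_, learn_singleton _, learn_large, not_learn⟩
  · refine Set.ssubset_iff_subset_ne.2 ⟨by rintro _ rfl; exact ⟨_, rfl⟩, fun h => ?_⟩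
    have : hyp (fun _ => true) ∈ ({hyp fun _ => false} : Set _) := h ▸ ⟨_, rfl⟩
    have := congrFun (Set.mem_singleton_iff.1 this) (0, true)
    simp [hyp] at this
  · refine Set.ssubset_insert ?_
    rintro ⟨g, hg⟩
    have := congrFun hg (0, !(g 0))
    simp [hyp, hypNone] at this
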